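/- arXiv:1701.06540 — 2 statements merged into one kernel-verified Lean document; each statement's English description precedes it below -/
import Mathlib

section
/- Let B ⊂ ℝⁿ satisfy one of the following: (i) B is a polyhedron such that B ∩ conv(S) has nonempty interior, the interior of B contains no point of S, and there is a point of S in the relative interior of each facet of B; (ii) B is a closed half-space such that B ∩ conv(S) has empty interior and the boundary hyperplane of B is a supporting hyperplane of conv(S); (iii) B is a hyperplane such that the cone lin(B) ∩ rec(conv(S)) is not generated by vectors with rational coordinates. Then B is a maximal S-free convex set. -/
open scoped BigOperators Pointwise

noncomputable section

/-- Euclidean space `ℝⁿ`. -/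
abbrev E (n : ℕ) := EuclideanSpace ℝ (Fin n)

/-- Dot product on `ℝⁿ`. -/
def dot {n : ℕ} (x y : E n) : ℝ := ∑ i, x i * y i

/-- A point with integral coordinates. -/
def IsIntPt {n : ℕ} (x : E n) : Prop := ∀ i, ∃ m : ℤ, x i = (m : ℝ)

/-- A vector with rational coordinates. -/
def IsRatVec {n : ℕ} (x : E n) : Prop := ∀ i, ∃ q : ℚ, x i = (q : ℝ)

/-- `S` is the set of integral points of a rational polyhedron `{x | Ax ≤ b}`. -/
def IsIntPtsOfRatPolyhedron {n : ℕ} (S : Set (E n)) : Prop :=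
  ∃ (m : ℕ) (A : Fin m → E n) (b : Fin m → ℝ),
    (∀ i, IsRatVec (A i)) ∧ (∀ i, ∃ q : ℚ, b i = (q : ℝ)) ∧
    S = {x | IsIntPt x ∧ ∀ i, dot (A i) x ≤ b i}

/-- `dim S = n`: `S` contains `n+1` affinely independent points. -/
def FullDimSet {n : ℕ} (S : Set (E n)) : Prop :=
  ∃ p : Fin (n + 1) → E n, (∀ i, p i ∈ S) ∧ AffineIndependent ℝ p

/-- `B` is `S`-free: the interior of `B` contains no point of `S`. -/
def SFree {n : ℕ} (S B : Set (E n)) : Prop := ∀ x ∈ interior B, x ∉ S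

/-- `B` is a maximal `S`-free convex set. -/
def MaxSFree {n : ℕ} (S B : Set (E n)) : Prop :=
  Convex ℝ B ∧ SFree S B ∧
    ∀ C : Set (E n), Convex ℝ C → SFree S C → B ⊆ C → B = C

/-- `B` is lattice-free: no integral point in its interior. -/
def LatticeFree {n : ℕ} (B : Set (E n)) : Prop := ∀ x ∈ interior B, ¬ IsIntPt x

/-- `B` is a maximal lattice-free convex set. -/
def MaxLatticeFree {n : ℕ} (B : Set (E n)) : Prop :=
  Convex ℝ B ∧ LatticeFree B ∧
    ∀ C : Set (E n), Convex ℝ C → LatticeFree C → B ⊆ C → B = C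

/-- A polyhedron: finite intersection of closed half-spaces. -/
def IsPolyhedron {n : ℕ} (B : Set (E n)) : Prop :=
  ∃ (m : ℕ) (a : Fin m → E n) (c : Fin m → ℝ), B = {x | ∀ i, dot (a i) x ≤ c i}

/-- A polytope: convex hull of finitely many points. -/
def IsPolytope {n : ℕ} (P : Set (E n)) : Prop :=
  ∃ V : Finset (E n), P = convexHull ℝ (V : Set (E n))

/-- Dimension of a set: dimension of its affine hull. -/
def sdim {n : ℕ} (A : Set (E n)) : ℕ := Module.finrank ℝ (affineSpan ℝ A).direction

/-- `F` is a face of the convex set `B`. -/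
def IsFaceOf {n : ℕ} (F B : Set (E n)) : Prop :=
  F ⊆ B ∧ Convex ℝ F ∧ ∀ x ∈ B, ∀ y ∈ B, ∀ t : ℝ, 0 < t → t < 1 →
    t • x + (1 - t) • y ∈ F → x ∈ F ∧ y ∈ F

/-- `F` is a facet of `B`: a nonempty face of dimension `dim B - 1`. -/
def IsFacetOf {n : ℕ} (F B : Set (E n)) : Prop :=
  IsFaceOf F B ∧ F.Nonempty ∧ sdim F + 1 = sdim B

/-- Recession cone of `K`. -/
def recCone {n : ℕ} (K : Set (E n)) : Set (E n) :=
  {d | ∀ x ∈ K, ∀ t : ℝ, 0 ≤ t → x + t • d ∈ K}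

/-- Lineality space of `K`. -/
def linSpace {n : ℕ} (K : Set (E n)) : Set (E n) :=
  {d | d ∈ recCone K ∧ -d ∈ recCone K}

/-- The set of all finite nonnegative combinations of elements of `G`. -/
def conicHullOf {n : ℕ} (G : Set (E n)) : Set (E n) :=
  {x | ∃ (m : ℕ) (c : Fin m → ℝ) (v : Fin m → E n),
    (∀ i, 0 ≤ c i) ∧ (∀ i, v i ∈ G) ∧ x = ∑ i, c i • v i}

/-- A cone is rational if it is generated by vectors with rational coordinates. -/
def IsRationalCone {n : ℕ} (C : Set (E n)) : Prop :=
  ∃ G : Set (E n), (∀ v ∈ G, IsRatVec v) ∧ C = conicHullOf G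

/-- A linear subspace is rational if it is spanned by rational vectors. -/
def IsRationalSubspace {n : ℕ} (L : Submodule ℝ (E n)) : Prop :=
  ∃ G : Set (E n), (∀ v ∈ G, IsRatVec v) ∧ L = Submodule.span ℝ G

/-- The hyperplane `{x | a·x = β}` is a supporting hyperplane of `C`. -/
def IsSupportingHyperplane {n : ℕ} (a : E n) (β : ℝ) (C : Set (E n)) : Prop :=
  ((∀ x ∈ C, dot a x ≤ β) ∨ (∀ x ∈ C, β ≤ dot a x)) ∧
    ∃ x ∈ closure C, dot a x = β

/-- `ψ` is a valid function with respect to `f` and `S`. -/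
def ValidFn {n : ℕ} (S : Set (E n)) (f : E n) (ψ : E n → ℝ) : Prop :=
  ∀ s : (E n) →₀ ℝ, (∀ r, 0 ≤ s r) →
    (f + s.sum fun r c => c • r) ∈ S →
    1 ≤ s.sum fun r c => ψ r * c

/-- Sublinear: positively homogeneous and subadditive. -/
def Sublinear {n : ℕ} (ψ : E n → ℝ) : Prop :=
  (∀ t : ℝ, 0 ≤ t → ∀ r, ψ (t • r) = t * ψ r) ∧
  (∀ r r', ψ (r + r') ≤ ψ r + ψ r')

/-- Polar of `K`. -/
def polar {n : ℕ} (K : Set (E n)) : Set (E n) := {y | ∀ r ∈ K, dot y r ≤ 1}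

/-- `K̂ = {y ∈ K* | ∃ x ∈ K, x·y = 1}`. -/
def Khat {n : ℕ} (K : Set (E n)) : Set (E n) :=
  {y | y ∈ polar K ∧ ∃ x ∈ K, dot x y = 1}

/-- `ρ_K(r) = sup { y·r | y ∈ K̂ }`. -/
def rho {n : ℕ} (K : Set (E n)) (r : E n) : ℝ :=
  sSup ((fun y => dot y r) '' Khat K)


lemma dot_eq_inner {n : ℕ} (x y : E n) : dot x y = inner ℝ x y := by
  simp [dot, PiLp.inner_apply, mul_comm]

lemma dot_add_r {n : ℕ} (a x y : E n) : dot a (x + y) = dot a x + dot a y := by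
  simp [dot_eq_inner, inner_add_right]

lemma dot_sub_r {n : ℕ} (a x y : E n) : dot a (x - y) = dot a x - dot a y := by
  simp [dot_eq_inner, inner_sub_right]

lemma dot_smul_r {n : ℕ} (a : E n) (t : ℝ) (x : E n) : dot a (t • x) = t * dot a x := by
  simp [dot_eq_inner, inner_smul_right]

lemma dot_neg_r {n : ℕ} (a x : E n) : dot a (-x) = - dot a x := by
  simp [dot_eq_inner]

lemma dot_neg_l {n : ℕ} (a x : E n) : dot (-a) x = - dot a x := by
  simp [dot_eq_inner]

lemma dot_zero_r {n : ℕ} (a : E n) : dot a 0 = 0 := by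
  simp [dot_eq_inner]

lemma dot_sum_r {n : ℕ} {J : Type*} [Fintype J] (a : E n) (f : J → E n) :
    dot a (∑ j, f j) = ∑ j, dot a (f j) := by
  simp [dot_eq_inner, inner_sum]

lemma dot_self_pos {n : ℕ} (a : E n) (h : a ≠ 0) : 0 < dot a a := by
  rw [dot_eq_inner]; exact real_inner_self_pos.2 h

lemma continuous_dot {n : ℕ} (a : E n) : Continuous (fun x => dot a x) := by
  simp only [dot_eq_inner]; fun_prop

lemma slab {n : ℕ} (a : E n) (β : ℝ) (C : Set (E n)) (hC : Convex ℝ C)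
    (hB : ∀ x, dot a x = β → x ∈ C) (c : E n) (hc : c ∈ C) (hac : β < dot a c)
    (x : E n) (h1 : β < dot a x) (h2 : dot a x < dot a c) : x ∈ C := by
  set t := (dot a x - β) / (dot a c - β) with ht
  have hpos : 0 < dot a c - β := by linarith
  have ht0 : 0 < t := div_pos (by linarith) hpos
  have ht1 : t < 1 := by rw [ht, div_lt_one hpos]; linarith
  have hts : t * (dot a c - β) = dot a x - β := by rw [ht]; field_simp
  have h1t : (1 - t) ≠ 0 := by linarith
  have hy : (1 - t)⁻¹ • (x - t • c) ∈ C := by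
    apply hB
    rw [dot_smul_r, dot_sub_r, dot_smul_r]
    field_simp
    linarith
  have := hC hc hy ht0.le (by linarith : (0:ℝ) ≤ 1 - t) (by ring)
  rw [smul_smul, mul_inv_cancel₀ h1t] at this
  simpa using this

lemma dens (x y : ℝ) (hx : 0 < x) (hy : 0 < y) (h : Irrational (x / y)) (β ε : ℝ) (hε : 0 < ε) :
    ∃ p q : ℕ, β < p * x - q * y ∧ p * x - q * y < β + ε := by
  have : Fact (0 < y) := ⟨hy⟩
  have hd := AddCircle.denseRange_zsmul_coe_iff.2 h
  have hm : MapClusterPt ((β + ε / 2 : ℝ) : AddCircle y) Filter.atTop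
      ((· • (x : AddCircle y)) : ℕ → AddCircle y) :=
    ((mapClusterPt_atTop_nsmul_tfae ((β + ε / 2 : ℝ) : AddCircle y) (x : AddCircle y)).out 3 0).1
      (hd _)
  have hn : ((fun t : ℝ => (t : AddCircle y)) '' Set.Ioo β (β + ε)) ∈
      nhds ((β + ε / 2 : ℝ) : AddCircle y) := by
    apply IsOpen.mem_nhds
    · exact QuotientAddGroup.isOpenMap_coe _ isOpen_Ioo
    · exact ⟨β + ε / 2, ⟨by linarith, by linarith⟩, rfl⟩
  have hf := (mapClusterPt_iff_frequently.1 hm) _ hn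
  have he : ∀ᶠ n : ℕ in Filter.atTop, β + ε < (n : ℝ) * x := by
    obtain ⟨N, hN⟩ := exists_nat_gt ((β + ε) / x)
    filter_upwards [Filter.eventually_ge_atTop N] with n hn
    have : (N : ℝ) ≤ n := by exact_mod_cast hn
    rw [div_lt_iff₀ hx] at hN
    nlinarith
  obtain ⟨p, ⟨t, ht, hpt⟩, hp⟩ := (hf.and_eventually he).exists
  have hpt' : ((p * x - t : ℝ) : AddCircle y) = 0 := by
    have : (t : AddCircle y) = p • (x : AddCircle y) := hpt
    rw [AddCircle.coe_sub, this, ← AddCircle.coe_nsmul]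
    simp
  rw [AddCircle.coe_eq_zero_iff] at hpt'
  obtain ⟨k, hk⟩ := hpt'
  have hk' : (k : ℝ) * y = p * x - t := by simpa using hk
  have hkpos : (0 : ℝ) < k := by
    by_contra hcon
    have := mul_nonpos_of_nonpos_of_nonneg (not_lt.1 hcon) hy.le
    linarith [ht.2]
  have hk0 : 0 ≤ k := by exact_mod_cast hkpos.le
  lift k to ℕ using hk0
  refine ⟨p, k, ?_, ?_⟩
  · push_cast at hk'; linarith [ht.1]
  · push_cast at hk'; linarith [ht.2]

lemma rat_convexHull {k : ℕ} (U : Set (Fin k → ℝ)) (hU : IsOpen U) (e : Fin k → ℝ) (he : e ∈ U) :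
    e ∈ convexHull ℝ {x | x ∈ U ∧ ∃ q : Fin k → ℚ, ∀ i, x i = q i} := by
  obtain ⟨ε, hε, hball⟩ := Metric.isOpen_iff.1 hU e he
  have h1 : ∀ i, ∃ q : ℚ, e i - ε / 2 < q ∧ (q : ℝ) < e i := fun i => exists_rat_btwn (by linarith)
  have h2 : ∀ i, ∃ q : ℚ, e i < q ∧ (q : ℝ) < e i + ε / 2 := fun i => exists_rat_btwn (by linarith)
  choose l hl1 hl2 using h1
  choose r hr1 hr2 using h2
  have : e ∈ convexHull ℝ (Set.univ.pi (fun i => ({(l i : ℝ), (r i : ℝ)} : Set ℝ))) := by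
    apply mem_convexHull_pi
    intro i _
    rw [convexHull_pair, segment_eq_Icc (by linarith [hl2 i, hr1 i])]
    exact ⟨(hl2 i).le, (hr1 i).le⟩
  refine convexHull_mono ?_ this
  intro x hx
  have hx' : ∀ i, x i = l i ∨ x i = r i := fun i => by simpa using hx i (Set.mem_univ i)
  refine ⟨hball ?_, ?_⟩
  · rw [Metric.mem_ball]
    refine lt_of_le_of_lt ((dist_pi_le_iff (by positivity : 0 ≤ ε / 2)).2 ?_) (by linarith)
    intro i
    rw [Real.dist_eq, abs_le]
    rcases hx' i with h | h <;> rw [h] <;> constructor <;>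
      linarith [hl1 i, hl2 i, hr1 i, hr2 i]
  · have : ∀ i, ∃ q : ℚ, x i = q := fun i => by
      rcases hx' i with h | h
      · exact ⟨_, h⟩
      · exact ⟨_, h⟩
    choose q hq using this
    exact ⟨q, hq⟩

lemma clear_denoms {ι : Type*} [Fintype ι] (v : ι → ℚ) :
    ∃ (N : ℕ) (z : ι → ℤ), 0 < N ∧ ∀ i, (z i : ℚ) = N * v i := by
  classical
  have : ∀ i, ∃ z : ℤ, (z : ℚ) = (∏ j, (v j).den : ℕ) * v i := by
    intro i
    obtain ⟨m, hm⟩ := Finset.dvd_prod_of_mem (fun j => (v j).den) (Finset.mem_univ i)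
    refine ⟨m * (v i).num, ?_⟩
    rw [hm]
    push_cast
    have := Rat.mul_den_eq_num (v i)
    rw [← this]; ring
  choose z hz using this
  exact ⟨_, z, Finset.prod_pos fun j _ => (v j).den_pos, hz⟩

lemma ratcone {ι κ : Type*} [Fintype ι] [Fintype κ] (A : κ → ι → ℚ) (d : ι → ℝ)
    (h : ∀ k, ∑ i, (A k i : ℝ) * d i ≤ 0) :
    ∃ (J : Type) (_ : Fintype J) (c : J → ℝ) (v : J → ι → ℤ), (∀ j, 0 ≤ c j) ∧
      (∀ j k, ∑ i, (A k i : ℝ) * v j i ≤ 0) ∧ ∀ i, d i = ∑ j, c j * v j i := by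
  classical
  let W := Submodule.span ℚ (Set.range d)
  have : FiniteDimensional ℚ W := FiniteDimensional.span_of_finite ℚ (Set.finite_range d)
  let b := Module.finBasis ℚ W
  set e : Fin _ → ℝ := fun j => (b j : ℝ) with he
  let q : Fin _ → ι → ℚ := fun j i => b.repr ⟨d i, Submodule.subset_span ⟨i, rfl⟩⟩ j
  have hd : ∀ i, d i = ∑ j, (q j i : ℝ) * e j := by
    intro i
    have := congrArg Subtype.val (b.sum_repr ⟨d i, Submodule.subset_span ⟨i, rfl⟩⟩)
    simp only [Submodule.coe_sum, Submodule.coe_smul] at this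
    rw [← this]
    refine Finset.sum_congr rfl fun j _ => ?_
    rw [Rat.smul_def]
  have hli : LinearIndependent ℚ e := b.linearIndependent.map' W.subtype W.ker_subtype
  let f : κ → Fin _ → ℚ := fun k j => ∑ i, A k i * q j i
  have hf : ∀ (k : κ) (e' : Fin _ → ℝ),
      ∑ i, (A k i : ℝ) * (∑ j, (q j i : ℝ) * e' j) = ∑ j, (f k j : ℝ) * e' j := by
    intro k e'
    simp only [f, Finset.mul_sum]
    rw [Finset.sum_comm]
    refine Finset.sum_congr rfl fun j _ => ?_
    push_cast
    rw [Finset.sum_mul]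
    refine Finset.sum_congr rfl fun i _ => by ring
  let U : Set (Fin _ → ℝ) := {e' | ∀ k, (∑ j, (f k j : ℝ) * e j < 0) → ∑ j, (f k j : ℝ) * e' j < 0}
  have hUo : IsOpen U := by
    have : U = ⋂ k, {e' | (∑ j, (f k j : ℝ) * e j < 0) → ∑ j, (f k j : ℝ) * e' j < 0} := by
      ext; simp [U]
    rw [this]
    refine isOpen_iInter_of_finite fun k => ?_
    by_cases hk : ∑ j, (f k j : ℝ) * e j < 0
    · simp only [hk, true_imp_iff]
      exact isOpen_lt (by fun_prop) continuous_const
    · simp [hk]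
  have heU : e ∈ U := fun k hk => hk
  have hmem := rat_convexHull U hUo e heU
  rw [mem_convexHull_iff_exists_fintype] at hmem
  obtain ⟨J, _, w, z, hw0, hw1, hz, hsum⟩ := hmem
  have hU : ∀ e' ∈ U, ∀ k, ∑ j, (f k j : ℝ) * e' j ≤ 0 := by
    intro e' he' k
    rcases lt_or_eq_of_le ((hf k e) ▸ (by simpa only [← hd] using h k) :
      ∑ j, (f k j : ℝ) * e j ≤ 0) with h1 | h1
    · exact (he' k h1).le
    · have : ∀ j, f k j = 0 := by
        apply Fintype.linearIndependent_iff.1 hli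
        rw [← h1]
        refine Finset.sum_congr rfl fun j _ => ?_
        rw [Rat.smul_def]
      simp [this]
  choose hzU r hr using hz
  have hcl := fun s : J => clear_denoms (fun i => ∑ j, q j i * r s j)
  choose N y hN hy using hcl
  have hyR : ∀ s i, (y s i : ℝ) = N s * ∑ j, (q j i : ℝ) * z s j := by
    intro s i
    have := congrArg (fun t : ℚ => (t : ℝ)) (hy s i)
    simp only [hr]
    push_cast at this
    exact this
  refine ⟨J, inferInstance, fun s => w s / N s, y, fun s => by
    have := hw0 s; positivity, ?_, ?_⟩
  · intro s k
    have h1 : ∑ i, (A k i : ℝ) * y s i = N s * ∑ i, (A k i : ℝ) * ∑ j, (q j i : ℝ) * z s j := by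
      rw [Finset.mul_sum]
      refine Finset.sum_congr rfl fun i _ => ?_
      rw [hyR]; ring
    rw [h1, hf]
    exact mul_nonpos_of_nonneg_of_nonpos (by positivity) (hU _ (hzU s) k)
  · intro i
    have h1 : ∀ s, w s / N s * y s i = ∑ j, (q j i : ℝ) * (w s * z s j) := by
      intro s
      rw [hyR]
      have : (N s : ℝ) ≠ 0 := by exact_mod_cast (hN s).ne'
      rw [Finset.mul_sum, Finset.mul_sum]
      refine Finset.sum_congr rfl fun j _ => ?_
      field_simp
    simp only [h1]
    rw [Finset.sum_comm, hd]
    refine Finset.sum_congr rfl fun j _ => ?_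
    rw [← Finset.mul_sum, ← hsum]
    simp

lemma mem_conicHullOf {n : ℕ} {J : Type*} [Fintype J] (G : Set (E n)) (c : J → ℝ) (v : J → E n)
    (hc : ∀ j, 0 ≤ c j) (hv : ∀ j, v j ∈ G) : ∑ j, c j • v j ∈ conicHullOf G := by
  classical
  let e := Fintype.equivFin J
  refine ⟨Fintype.card J, fun i => c (e.symm i), fun i => v (e.symm i), fun i => hc _,
    fun i => hv _, ?_⟩
  exact (Equiv.sum_comp e.symm (fun j => c j • v j)).symm

lemma interior_conv_nonempty {n : ℕ} {S : Set (E n)} (h : FullDimSet S) :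
    (interior (convexHull ℝ S)).Nonempty := by
  obtain ⟨p, hp, hi⟩ := h
  rw [interior_convexHull_nonempty_iff_affineSpan_eq_top]
  have h1 : affineSpan ℝ (Set.range p) = ⊤ := by
    rw [hi.affineSpan_eq_top_iff_card_eq_finrank_add_one]
    simp
  rw [eq_top_iff, ← h1]
  exact affineSpan_mono ℝ (by rintro _ ⟨i, rfl⟩; exact hp i)

/-- The real vector with given integer coordinates. -/
def ofZ {n : ℕ} (z : Fin n → ℤ) : E n := WithLp.toLp 2 (fun i => (z i : ℝ))

lemma ofZ_apply {n : ℕ} (z : Fin n → ℤ) (i : Fin n) : ofZ z i = z i := rfl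

lemma ofZ_rat {n : ℕ} (z : Fin n → ℤ) : IsRatVec (ofZ z) := fun i => ⟨z i, by simp [ofZ_apply]⟩

lemma cone_gen {n m : ℕ} (A : Fin m → E n) (hA : ∀ i, IsRatVec (A i)) (d : E n)
    (hd : ∀ i, dot (A i) d ≤ 0) :
    ∃ (J : Type) (_ : Fintype J) (c : J → ℝ) (v : J → Fin n → ℤ), (∀ j, 0 ≤ c j) ∧
      (∀ j i, dot (A i) (ofZ (v j)) ≤ 0) ∧ d = ∑ j, c j • ofZ (v j) := by
  choose q hq using hA
  obtain ⟨J, hJ, c, v, h1, h2, h3⟩ := ratcone q d (fun k => by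
    simpa only [dot, hq] using hd k)
  refine ⟨J, hJ, c, v, h1, fun j i => ?_, ?_⟩
  · simpa only [dot, hq, ofZ_apply] using h2 j i
  · ext i
    simpa [ofZ_apply] using h3 i

lemma S_add {n m : ℕ} (A : Fin m → E n) (b : Fin m → ℝ) (s : E n)
    (hs : IsIntPt s ∧ ∀ i, dot (A i) s ≤ b i) (v : Fin n → ℤ)
    (hv : ∀ i, dot (A i) (ofZ v) ≤ 0) (p : ℕ) :
    IsIntPt (s + (p : ℝ) • ofZ v) ∧ ∀ i, dot (A i) (s + (p : ℝ) • ofZ v) ≤ b i := by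
  constructor
  · intro i
    obtain ⟨k, hk⟩ := hs.1 i
    refine ⟨k + p * v i, ?_⟩
    simp [ofZ_apply, hk]
  · intro i
    rw [dot_add_r, dot_smul_r]
    have := mul_nonpos_of_nonneg_of_nonpos (Nat.cast_nonneg (α := ℝ) p) (hv i)
    linarith [hs.2 i]

lemma recCone_add {n : ℕ} {K : Set (E n)} {d e : E n} (hd : d ∈ recCone K) (he : e ∈ recCone K) :
    d + e ∈ recCone K := by
  intro x hx t ht
  have := he _ (hd x hx t ht) t ht
  rwa [add_assoc, ← smul_add] at this

lemma recCone_smul {n : ℕ} {K : Set (E n)} {d : E n} (hd : d ∈ recCone K) {c : ℝ} (hc : 0 ≤ c) :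
    c • d ∈ recCone K := by
  intro x hx t ht
  rw [smul_smul]
  exact hd x hx _ (mul_nonneg ht hc)

lemma recCone_zero {n : ℕ} {K : Set (E n)} : (0 : E n) ∈ recCone K := by
  intro x hx t ht
  simpa using hx

lemma recCone_sum {n : ℕ} {K : Set (E n)} {J : Type*} [Fintype J] (c : J → ℝ) (v : J → E n)
    (hc : ∀ j, 0 ≤ c j) (hv : ∀ j, v j ∈ recCone K) : ∑ j, c j • v j ∈ recCone K :=
  Finset.sum_induction _ (· ∈ recCone K) (fun _ _ => recCone_add) recCone_zero
    (fun j _ => recCone_smul (hv j) (hc j))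

lemma int_recCone {n m : ℕ} (A : Fin m → E n) (b : Fin m → ℝ) (S : Set (E n))
    (hS : S = {x | IsIntPt x ∧ ∀ i, dot (A i) x ≤ b i}) (v : Fin n → ℤ)
    (hv : ∀ i, dot (A i) (ofZ v) ≤ 0) : ofZ v ∈ recCone (convexHull ℝ S) := by
  intro x hx t ht
  have hconv : Convex ℝ ((fun x => x + t • ofZ v) ⁻¹' (convexHull ℝ S)) :=
    (convex_convexHull ℝ S).translate_preimage_left (t • ofZ v)
  refine convexHull_min ?_ hconv hx
  intro s hs
  have hs' : IsIntPt s ∧ ∀ i, dot (A i) s ≤ b i := by rw [hS] at hs; exact hs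
  obtain ⟨p, hp⟩ := exists_nat_gt t
  have hp0 : (0 : ℝ) < p := lt_of_le_of_lt ht hp
  have h1 : s + (p : ℝ) • ofZ v ∈ convexHull ℝ S := by
    apply subset_convexHull
    rw [hS]
    exact S_add A b s hs' v hv p
  have h2 := convex_convexHull ℝ S h1 (subset_convexHull ℝ S hs)
    (by positivity : (0 : ℝ) ≤ t / p) (by rw [sub_nonneg, div_le_one hp0]; exact hp.le :
      (0 : ℝ) ≤ 1 - t / p) (by ring)
  show s + t • ofZ v ∈ convexHull ℝ S
  convert h2 using 1
  have : t = t / p * p := by field_simp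
  rw [smul_add, smul_smul, ← this, sub_smul, one_smul]
  abel

lemma recCone_sub {n m : ℕ} (A : Fin m → E n) (b : Fin m → ℝ) (S : Set (E n))
    (hS : S = {x | IsIntPt x ∧ ∀ i, dot (A i) x ≤ b i}) (hne : S.Nonempty) (d : E n)
    (hd : d ∈ recCone (convexHull ℝ S)) : ∀ i, dot (A i) d ≤ 0 := by
  intro i
  obtain ⟨s, hs⟩ := hne
  have hsub : convexHull ℝ S ⊆ {x | dot (A i) x ≤ b i} := by
    apply convexHull_min
    · rw [hS]; exact fun x hx => hx.2 i
    · have : {x | dot (A i) x ≤ b i} = {x | (innerSL ℝ (A i)) x ≤ b i} := by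
        ext x; simp [dot_eq_inner]
      rw [this]
      exact convex_halfSpace_le (innerSL ℝ (A i)).isLinear _
  by_contra hcon
  push Not at hcon
  obtain ⟨N, hN⟩ := exists_nat_gt ((b i - dot (A i) s) / dot (A i) d)
  rw [div_lt_iff₀ hcon] at hN
  have := hsub (hd s (subset_convexHull ℝ S hs) N (by positivity))
  simp only [Set.mem_ofPred_eq, dot_add_r, dot_smul_r] at this
  linarith

lemma linSpace_hyperplane {n : ℕ} (a : E n) (ha : a ≠ 0) (β : ℝ) :
    linSpace {x | dot a x = β} = {d | dot a d = 0} := by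
  ext d
  constructor
  · intro h
    have h0 : dot a ((β / dot a a) • a) = β := by
      rw [dot_smul_r]; have := (dot_self_pos a ha).ne'; field_simp
    have := h.1 _ h0 1 zero_le_one
    simp only [Set.mem_ofPred_eq, dot_add_r, h0, one_smul] at this
    simpa using this
  · intro h
    have h : dot a d = 0 := h
    constructor
    · intro x hx t _
      simp only [Set.mem_ofPred_eq] at hx ⊢
      simp [dot_add_r, dot_smul_r, h, hx]
    · intro x hx t _
      simp only [Set.mem_ofPred_eq] at hx ⊢
      rw [dot_add_r, dot_smul_r, dot_neg_r]
      simp [h, hx]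

lemma rational_of_ratios {n m : ℕ} (A : Fin m → E n) (hA : ∀ i, IsRatVec (A i)) (b : Fin m → ℝ)
    (S : Set (E n)) (hS : S = {x | IsIntPt x ∧ ∀ i, dot (A i) x ≤ b i}) (hne : S.Nonempty)
    (a : E n)
    (H : ∀ v w : Fin n → ℤ, (∀ i, dot (A i) (ofZ v) ≤ 0) → (∀ i, dot (A i) (ofZ w) ≤ 0) →
      0 < dot a (ofZ v) → dot a (ofZ w) < 0 → ∃ r : ℚ, (r : ℝ) = dot a (ofZ v) / dot a (ofZ w)) :
    IsRationalCone ({d | dot a d = 0} ∩ recCone (convexHull ℝ S)) := by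
  classical
  refine ⟨{v | IsRatVec v ∧ v ∈ {d | dot a d = 0} ∩ recCone (convexHull ℝ S)}, fun v hv => hv.1, ?_⟩
  apply Set.Subset.antisymm
  swap
  · rintro x ⟨k, c, v, hc, hv, rfl⟩
    refine ⟨?_, recCone_sum c v hc fun j => (hv j).2.2⟩
    show dot a _ = 0
    rw [dot_sum_r]
    refine Finset.sum_eq_zero fun j _ => ?_
    rw [dot_smul_r, show dot a (v j) = 0 from (hv j).2.1, mul_zero]
  rintro d ⟨hd0, hdrec⟩
  have hd0 : dot a d = 0 := hd0
  obtain ⟨J, hJ, c, v, hc, hv, hd⟩ := cone_gen A hA d (recCone_sub A b S hS hne d hdrec)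
  have hsum : ∑ j, c j * dot a (ofZ (v j)) = 0 := by
    rw [hd, dot_sum_r] at hd0
    simpa only [dot_smul_r] using hd0
  have key : (∀ j, c j * dot a (ofZ (v j)) = 0) ∨
      ∃ θ : ℝ, ∃ r : J → ℚ, θ ≠ 0 ∧ ∀ j, dot a (ofZ (v j)) = r j * θ := by
    by_cases hp : ∃ j, 0 < dot a (ofZ (v j))
    · by_cases hn : ∃ j, dot a (ofZ (v j)) < 0
      · right
        obtain ⟨j, hj⟩ := hp
        obtain ⟨l, hl⟩ := hn
        obtain ⟨r0, hr0⟩ := H (v j) (v l) (hv j) (hv l) hj hl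
        refine ⟨dot a (ofZ (v l)), ?_⟩
        have : ∀ k, ∃ r : ℚ, dot a (ofZ (v k)) = r * dot a (ofZ (v l)) := by
          intro k
          rcases lt_trichotomy (dot a (ofZ (v k))) 0 with hk | hk | hk
          · obtain ⟨r1, hr1⟩ := H (v j) (v k) (hv j) (hv k) hj hk
            refine ⟨r0 / r1, ?_⟩
            push_cast
            rw [hr0, hr1]
            have := hj.ne'; have := hl.ne; have := hk.ne
            field_simp
          · exact ⟨0, by simp [hk]⟩
          · obtain ⟨r1, hr1⟩ := H (v k) (v l) (hv k) (hv l) hk hl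
            refine ⟨r1, ?_⟩
            rw [hr1]
            have := hl.ne
            field_simp
        choose r hr using this
        exact ⟨r, hl.ne, hr⟩
      · left
        push Not at hn
        have := (Finset.sum_eq_zero_iff_of_nonneg (fun j _ => mul_nonneg (hc j) (hn j))).1 hsum
        exact fun j => this j (Finset.mem_univ j)
    · left
      push Not at hp
      have := (Finset.sum_eq_zero_iff_of_nonpos
        (fun j _ => mul_nonpos_of_nonneg_of_nonpos (hc j) (hp j))).1 hsum
      exact fun j => this j (Finset.mem_univ j)
  rcases key with h0 | ⟨θ, r, hθ, hr⟩
  · have hd' : d = ∑ j, c j • (if dot a (ofZ (v j)) = 0 then ofZ (v j) else 0) := by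
      rw [hd]
      refine Finset.sum_congr rfl fun j _ => ?_
      split_ifs with h
      · rfl
      · rcases mul_eq_zero.1 (h0 j) with h' | h'
        · simp [h']
        · exact absurd h' h
    rw [hd']
    apply mem_conicHullOf _ _ _ hc
    intro j
    split_ifs with h
    · exact ⟨ofZ_rat _, h, int_recCone A b S hS _ (hv j)⟩
    · exact ⟨fun i => ⟨0, by simp⟩, dot_zero_r a, recCone_zero⟩
  · have hrc : ∑ j, (r j : ℝ) * c j = 0 := by
      have : (∑ j, (r j : ℝ) * c j) * θ = 0 := by
        rw [← hsum, Finset.sum_mul]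
        refine Finset.sum_congr rfl fun j _ => ?_
        rw [hr]; ring
      exact (mul_eq_zero.1 this).resolve_right hθ
    obtain ⟨L, hL, μ, w, hμ, hw, hcw⟩ := ratcone (κ := J ⊕ Bool)
      (fun k => match k with
        | Sum.inl j => fun i => if i = j then -1 else 0
        | Sum.inr true => r
        | Sum.inr false => -r) c (by
        rintro (j | _ | _)
        · simpa [apply_ite (Rat.cast : ℚ → ℝ)] using hc j
        · simp [hrc]
        · simp [hrc])
    have hw1 : ∀ l j, (0 : ℝ) ≤ w l j := fun l j => by
      simpa [apply_ite (Rat.cast : ℚ → ℝ)] using hw l (Sum.inl j)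
    have hw2 : ∀ l, ∑ j, (r j : ℝ) * w l j = 0 := fun l => by
      have h1 := hw l (Sum.inr true)
      have h2 := hw l (Sum.inr false)
      simp at h1 h2
      linarith
    have hd' : d = ∑ l, μ l • (∑ j, (w l j : ℝ) • ofZ (v j)) := by
      rw [hd]
      simp only [Finset.smul_sum]
      rw [Finset.sum_comm]
      refine Finset.sum_congr rfl fun j _ => ?_
      rw [hcw, Finset.sum_smul]
      simp only [smul_smul]
    rw [hd']
    apply mem_conicHullOf _ _ _ hμ
    intro l
    refine ⟨?_, ?_, ?_⟩
    · intro i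
      refine ⟨∑ j, w l j * v j i, ?_⟩
      simp [ofZ_apply]
    · show dot a _ = 0
      rw [dot_sum_r]
      simp only [dot_smul_r, hr]
      rw [← zero_mul θ, ← hw2 l, Finset.sum_mul]
      exact Finset.sum_congr rfl fun j _ => by ring
    · exact recCone_sum _ _ (hw1 l) fun j => int_recCone A b S hS _ (hv j)

lemma irr_dense {n : ℕ} (S : Set (E n)) (hS : IsIntPtsOfRatPolyhedron S) (hne : S.Nonempty)
    (a : E n) (h : ¬ IsRationalCone ({d | dot a d = 0} ∩ recCone (convexHull ℝ S)))
    (β ε : ℝ) (hε : 0 < ε) : ∃ s ∈ S, β < dot a s ∧ dot a s < β + ε := by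
  obtain ⟨m, A, b, hA, -, hSe⟩ := hS
  have := mt (rational_of_ratios A hA b S hSe hne a) h
  push Not at this
  obtain ⟨v, w, hv, hw, hpos, hneg, hirr⟩ := this
  obtain ⟨s, hs⟩ := hne
  have hirr' : Irrational (dot a (ofZ v) / (- dot a (ofZ w))) := by
    rintro ⟨q, hq⟩
    apply hirr (-q)
    push_cast
    rw [hq, div_neg, neg_neg]
  obtain ⟨p, q, h1, h2⟩ := dens _ _ hpos (neg_pos.2 hneg) hirr' (β - dot a s) ε hε
  refine ⟨s + (p : ℝ) • ofZ v + (q : ℝ) • ofZ w, ?_, ?_, ?_⟩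
  · rw [hSe] at hs ⊢
    exact S_add A b _ (S_add A b s hs v hv p) w hw q
  · simp only [dot_add_r, dot_smul_r]; linarith
  · simp only [dot_add_r, dot_smul_r]; linarith

lemma convex_le {n : ℕ} (a : E n) (β : ℝ) : Convex ℝ {x | dot a x ≤ β} := by
  have : {x | dot a x ≤ β} = {x | (innerSL ℝ a) x ≤ β} := by
    ext x; simp [dot_eq_inner]
  rw [this]
  exact convex_halfSpace_le (innerSL ℝ a).isLinear _

lemma convex_ge {n : ℕ} (a : E n) (β : ℝ) : Convex ℝ {x | β ≤ dot a x} := by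
  have := convex_le (-a) (-β)
  simpa only [dot_neg_l, neg_le_neg_iff] using this

lemma convex_eq {n : ℕ} (a : E n) (β : ℝ) : Convex ℝ {x | dot a x = β} := by
  have : {x | dot a x = β} = {x | dot a x ≤ β} ∩ {x | β ≤ dot a x} := by
    ext x; simp [le_antisymm_iff]
  rw [this]
  exact (convex_le a β).inter (convex_ge a β)

/-- No interior point of a half-space lies on the boundary hyperplane. -/
lemma interior_half {n : ℕ} (a : E n) (ha : a ≠ 0) (β : ℝ) (x : E n)
    (hx : x ∈ interior {x | dot a x ≤ β}) : dot a x < β := by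
  have h1 : Filter.Tendsto (fun t : ℝ => x + t • a) (nhds 0) (nhds x) := by
    have : Continuous (fun t : ℝ => x + t • a) := by fun_prop
    simpa using this.tendsto 0
  have h2 : ∀ᶠ t : ℝ in nhds 0, dot a (x + t • a) ≤ β := h1 (mem_interior_iff_mem_nhds.1 hx)
  obtain ⟨ε, hε, hb⟩ := Metric.eventually_nhds_iff.1 h2
  have := hb (y := ε / 2) (by rw [Real.dist_eq, sub_zero, abs_of_pos (by positivity)]; linarith)
  rw [dot_add_r, dot_smul_r] at this
  have : 0 < ε / 2 * dot a a := mul_pos (by positivity) (dot_self_pos a ha)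
  linarith

lemma case_iii_side {n : ℕ} (S : Set (E n)) (a : E n) (β : ℝ)
    (hd : ∀ β ε : ℝ, 0 < ε → ∃ s ∈ S, β < dot a s ∧ dot a s < β + ε)
    (C : Set (E n)) (hC : Convex ℝ C) (hfree : SFree S C) (hB : {x | dot a x = β} ⊆ C)
    (c : E n) (hc : c ∈ C) : dot a c ≤ β := by
  by_contra hcon
  push Not at hcon
  obtain ⟨s, hs, h1, h2⟩ := hd β (dot a c - β) (by linarith)
  refine hfree s ?_ hs
  have hopen : IsOpen {x | β < dot a x ∧ dot a x < dot a c} :=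
    (isOpen_lt continuous_const (continuous_dot a)).inter
      (isOpen_lt (continuous_dot a) continuous_const)
  refine interior_maximal ?_ hopen ⟨h1, by linarith⟩
  rintro x ⟨hx1, hx2⟩
  exact slab a β C hC (fun x hx => hB hx) c hc hcon x hx1 hx2

lemma case_iii {n : ℕ} (S : Set (E n)) (hS : IsIntPtsOfRatPolyhedron S)
    (hne : S.Nonempty) (a : E n) (β : ℝ) (ha : a ≠ 0)
    (h : ¬ IsRationalCone (linSpace {x | dot a x = β} ∩ recCone (convexHull ℝ S))) :
    MaxSFree S {x | dot a x = β} := by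
  rw [linSpace_hyperplane a ha] at h
  have hd := irr_dense S hS hne a h
  refine ⟨convex_eq a β, ?_, ?_⟩
  · intro x hx
    have h1 := interior_half a ha β x (interior_mono (fun y hy => le_of_eq hy) hx)
    have h2 : x ∈ {x | dot a x = β} := interior_subset hx
    have h2 : dot a x = β := h2
    linarith
  · intro C hC hfree hB
    refine Set.Subset.antisymm hB fun c hc => ?_
    refine le_antisymm (case_iii_side S a β hd C hC hfree hB c hc) ?_
    have := case_iii_side S (-a) (-β) ?_ C hC hfree
      (fun x hx => hB (by simpa only [Set.mem_ofPred_eq, dot_neg_l, neg_inj] using hx)) c hc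
    · rw [dot_neg_l] at this; linarith
    · intro β' ε hε
      obtain ⟨s, hs, h1, h2⟩ := hd (-β' - ε) ε hε
      exact ⟨s, hs, by rw [dot_neg_l]; linarith, by rw [dot_neg_l]; linarith⟩

lemma case_ii {n : ℕ} (S : Set (E n)) (hdim : FullDimSet S) (a : E n) (β : ℝ) (ha : a ≠ 0)
    (hemp : interior ({x | dot a x ≤ β} ∩ convexHull ℝ S) = ∅)
    (hsup : IsSupportingHyperplane a β (convexHull ℝ S)) : MaxSFree S {x | dot a x ≤ β} := by
  obtain ⟨hside, x0, hx0, hx0β⟩ := hsup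
  have hge : ∀ x ∈ convexHull ℝ S, β ≤ dot a x := by
    rcases hside with h | h
    · exfalso
      have : {x | dot a x ≤ β} ∩ convexHull ℝ S = convexHull ℝ S :=
        Set.inter_eq_right.2 fun x hx => h x hx
      rw [this] at hemp
      exact (interior_conv_nonempty hdim).ne_empty hemp
    · exact h
  refine ⟨convex_le a β, ?_, ?_⟩
  · intro x hx hxS
    have := interior_half a ha β x hx
    linarith [hge x (subset_convexHull ℝ S hxS)]
  · intro C hC hfree hB
    refine Set.Subset.antisymm hB fun c hc => ?_
    by_contra hcon
    have hcon : β < dot a c := not_le.1 hcon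
    have hopen : IsOpen {x | dot a x < dot a c} := isOpen_lt (continuous_dot a) continuous_const
    have hsub : {x | dot a x < dot a c} ⊆ C := by
      intro x hx
      by_cases hxβ : dot a x ≤ β
      · exact hB hxβ
      · exact slab a β C hC (fun x hx => hB (le_of_eq hx)) c hc hcon x (not_le.1 hxβ) hx
    have hS' : convexHull ℝ S ⊆ {x | dot a c ≤ dot a x} := by
      apply convexHull_min _ (convex_ge a _)
      intro s hs
      by_contra hlt
      have hlt : dot a s < dot a c := not_le.1 hlt
      have hlt' : s ∈ {x | dot a x < dot a c} := hlt
      exact hfree s (interior_maximal hsub hopen hlt') hs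
    have hcl : IsClosed {x | dot a c ≤ dot a x} :=
      isClosed_le continuous_const (continuous_dot a)
    have : dot a c ≤ dot a x0 := closure_minimal hS' hcl hx0
    linarith

lemma ev_strict {n : ℕ} (a : E n) (c : ℝ) (p d : E n) (h : dot a p < c) :
    ∀ᶠ t : ℝ in nhds 0, dot a (p + t • d) < c := by
  have : Continuous (fun t : ℝ => dot a (p + t • d)) := (continuous_dot a).comp (by fun_prop)
  have h2 := this.tendsto 0
  simp only [zero_smul, add_zero] at h2
  exact h2.eventually_lt_const h

lemma ev_pos {P : ℝ → Prop} (h : ∀ᶠ t : ℝ in nhds 0, P t) : ∃ t : ℝ, 0 < t ∧ P t := by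
  obtain ⟨ε, hε, hb⟩ := Metric.eventually_nhds_iff.1 h
  exact ⟨ε / 2, by positivity,
    hb (by rw [Real.dist_eq, sub_zero, abs_of_pos (by positivity)]; linarith)⟩

/-- A relative interior point can be pushed away from any other point of the set. -/
lemma intrinsic_push {n : ℕ} (F : Set (E n)) (z p : E n) (hz : z ∈ intrinsicInterior ℝ F)
    (hp : p ∈ F) : ∃ t : ℝ, 0 < t ∧ z + t • (z - p) ∈ F := by
  obtain ⟨z', hz', rfl⟩ := mem_intrinsicInterior.1 hz
  have hmem : ∀ t : ℝ, (z' : E n) + t • ((z' : E n) - p) ∈ affineSpan ℝ F := by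
    intro t
    have := AffineSubspace.vadd_mem_of_mem_direction (s := affineSpan ℝ F)
      (Submodule.smul_mem _ t (AffineSubspace.vsub_mem_direction z'.2 (subset_affineSpan ℝ F hp)))
      z'.2
    simpa [add_comm] using this
  let g : ℝ → affineSpan ℝ F := fun t => ⟨(z' : E n) + t • ((z' : E n) - p), hmem t⟩
  have hg : Continuous g := by
    apply Continuous.subtype_mk
    fun_prop
  have hg0 : g 0 = z' := by
    apply Subtype.ext
    simp [g]
  have h1 := hg.tendsto 0
  rw [hg0] at h1
  have h2 : ∀ᶠ t : ℝ in nhds 0, g t ∈ ((↑) ⁻¹' F : Set (affineSpan ℝ F)) :=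
    h1 (mem_interior_iff_mem_nhds.1 hz')
  exact ev_pos h2

lemma facet_dim {n : ℕ} (F B : Set (E n)) (a : E n) (ha : a ≠ 0) (β : ℝ)
    (hF : ∀ x ∈ F, dot a x = β) (p : E n) (hp : p ∈ F)
    (hloc : ∀ d, dot a d = 0 → ∃ t : ℝ, 0 < t ∧ p + t • d ∈ F)
    (hB : (interior B).Nonempty) : sdim F + 1 = sdim B := by
  have h1 : affineSpan ℝ B = ⊤ := by
    obtain ⟨x, hx⟩ := hB
    have := (isOpen_interior (s := B)).affineSpan_eq_top ⟨x, hx⟩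
    rw [eq_top_iff, ← this]
    exact affineSpan_mono ℝ interior_subset
  have h2 : (affineSpan ℝ F).direction = (Submodule.span ℝ {a})ᗮ := by
    apply le_antisymm
    · rw [direction_affineSpan, vectorSpan, Submodule.span_le]
      rintro _ ⟨x, hx, y, hy, rfl⟩
      rw [SetLike.mem_coe, Submodule.mem_orthogonal_singleton_iff_inner_right, ← dot_eq_inner]
      simp only [vsub_eq_sub, dot_sub_r, hF x hx, hF y hy, sub_self]
    · intro d hd
      rw [Submodule.mem_orthogonal_singleton_iff_inner_right, ← dot_eq_inner] at hd
      obtain ⟨t, ht, hm⟩ := hloc d hd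
      have := AffineSubspace.vsub_mem_direction (subset_affineSpan ℝ F hm)
        (subset_affineSpan ℝ F hp)
      simp only [vsub_eq_sub, add_sub_cancel_left] at this
      have h3 := Submodule.smul_mem _ t⁻¹ this
      rwa [smul_smul, inv_mul_cancel₀ ht.ne', one_smul] at h3
  have h3 := Submodule.finrank_add_finrank_orthogonal (Submodule.span ℝ {a})
  rw [finrank_span_singleton ha] at h3
  unfold sdim
  rw [h1, h2, AffineSubspace.direction_top, finrank_top]
  omega

lemma case_i {n : ℕ} (S B : Set (E n)) (hpoly : IsPolyhedron B)
    (hint : (interior B).Nonempty) (hfree : ∀ x ∈ interior B, x ∉ S)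
    (hfac : ∀ F : Set (E n), IsFacetOf F B → ∃ z ∈ S, z ∈ intrinsicInterior ℝ F) :
    MaxSFree S B := by
  classical
  obtain ⟨m, a, c, hB⟩ := hpoly
  have hBmem : ∀ x, x ∈ B ↔ ∀ i, dot (a i) x ≤ c i := fun x => by rw [hB]; rfl
  have hconv : Convex ℝ B := by
    have : B = ⋂ i, {x | dot (a i) x ≤ c i} := by
      ext x; rw [hBmem, Set.mem_iInter]; rfl
    rw [this]
    exact convex_iInter fun i => convex_le _ _
  refine ⟨hconv, hfree, ?_⟩
  intro C hC hCfree hBC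
  refine Set.Subset.antisymm hBC fun y hy => ?_
  by_contra hyB
  obtain ⟨J, hJ, hJmin⟩ := (Finset.isWellFounded_ssubset (α := Fin m)).wf.has_min
    {J | ∀ x, x ∈ B ↔ ∀ i ∈ J, dot (a i) x ≤ c i}
    ⟨Finset.univ, fun x => by simp [hBmem]⟩
  have hJ : ∀ x, x ∈ B ↔ ∀ i ∈ J, dot (a i) x ≤ c i := hJ
  obtain ⟨x0, hx0⟩ := hint
  have hx0B : x0 ∈ B := interior_subset hx0
  have hex : ∀ i ∈ J, ∃ w, (∀ j ∈ J, j ≠ i → dot (a j) w ≤ c j) ∧ c i < dot (a i) w := by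
    intro i hi
    by_contra hcon
    push Not at hcon
    refine hJmin (J.erase i) ?_ (Finset.erase_ssubset hi)
    intro x
    rw [hJ]
    constructor
    · intro h j hj
      exact h j (Finset.mem_of_mem_erase hj)
    · intro h j hj
      have h' : ∀ j ∈ J, j ≠ i → dot (a j) x ≤ c j := fun j hj hne =>
        h j (Finset.mem_erase.2 ⟨hne, hj⟩)
      by_cases hji : j = i
      · subst hji; exact hcon x h'
      · exact h' j hj hji
  have hane : ∀ i ∈ J, a i ≠ 0 := by
    intro i hi h0
    obtain ⟨w, -, hw⟩ := hex i hi
    have := (hJ x0).1 hx0B i hi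
    rw [h0] at this hw
    simp [dot_eq_inner] at this hw
    linarith
  have hx0s : ∀ i ∈ J, dot (a i) x0 < c i := by
    intro i hi
    apply interior_half (a i) (hane i hi)
    exact interior_mono (fun x hx => (hJ x).1 hx i hi) hx0
  obtain ⟨i, hi, hyi⟩ : ∃ i ∈ J, c i < dot (a i) y := by
    by_contra hcon
    push Not at hcon
    exact hyB ((hJ y).2 hcon)
  obtain ⟨w, hw1, hw2⟩ := hex i hi
  -- the point `p` on the segment from `x0` to `w`
  have hden : 0 < dot (a i) w - dot (a i) x0 := by linarith [hx0s i hi]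
  set s := (c i - dot (a i) x0) / (dot (a i) w - dot (a i) x0) with hs
  have hs0 : 0 < s := div_pos (by linarith [hx0s i hi]) hden
  have hs1 : s < 1 := by rw [hs, div_lt_one hden]; linarith
  have hsm : s * (dot (a i) w - dot (a i) x0) = c i - dot (a i) x0 := by rw [hs]; field_simp
  set p := x0 + s • (w - x0) with hp
  have hpi : dot (a i) p = c i := by
    rw [hp, dot_add_r, dot_smul_r, dot_sub_r, hsm]; ring
  have hpj : ∀ j ∈ J, j ≠ i → dot (a j) p < c j := by
    intro j hj hne
    rw [hp, dot_add_r, dot_smul_r, dot_sub_r]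
    nlinarith [hx0s j hj, hw1 j hj hne]
  set F : Set (E n) := {x | x ∈ B ∧ dot (a i) x = c i} with hF
  have hpF : p ∈ F := by
    refine ⟨(hJ p).2 fun j hj => ?_, hpi⟩
    by_cases hji : j = i
    · subst hji; exact hpi.le
    · exact (hpj j hj hji).le
  have hfacet : IsFacetOf F B := by
    refine ⟨⟨fun x hx => hx.1, hconv.inter (convex_eq (a i) (c i)), ?_⟩, ⟨p, hpF⟩, ?_⟩
    · intro x hx z hz t ht0 ht1 hm
      have h1 := (hJ x).1 hx i hi
      have h2 := (hJ z).1 hz i hi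
      have h3 := hm.2
      rw [dot_add_r, dot_smul_r, dot_smul_r] at h3
      have h1t : 0 < 1 - t := by linarith
      refine ⟨⟨hx, ?_⟩, ⟨hz, ?_⟩⟩
      · by_contra hne
        have := lt_of_le_of_ne h1 hne
        nlinarith
      · by_contra hne
        have := lt_of_le_of_ne h2 hne
        nlinarith
    · refine facet_dim F B (a i) (hane i hi) (c i) (fun x hx => hx.2) p hpF ?_ ⟨x0, hx0⟩
      intro d hd
      have hev : ∀ᶠ t : ℝ in nhds 0, ∀ j ∈ J, j ≠ i → dot (a j) (p + t • d) < c j := by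
        rw [Filter.eventually_all_finset]
        intro j hj
        by_cases hji : j = i
        · exact Filter.Eventually.of_forall fun t h => absurd hji h
        · filter_upwards [ev_strict (a j) (c j) p d (hpj j hj hji)] with t ht _ using ht
      obtain ⟨t, ht, hm⟩ := ev_pos hev
      have he : dot (a i) (p + t • d) = c i := by
        rw [dot_add_r, dot_smul_r, hd, hpi]; ring
      refine ⟨t, ht, (hJ _).2 fun j hj => ?_, he⟩
      by_cases hji : j = i
      · subst hji; exact he.le
      · exact (hm j hj hji).le
  obtain ⟨z, hzS, hz⟩ := hfac F hfacet
  have hzF : z ∈ F := intrinsicInterior_subset hz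
  have hzj : ∀ j ∈ J, j ≠ i → dot (a j) z < c j := by
    intro j hj hne
    obtain ⟨t, ht, hm⟩ := intrinsic_push F z p hz hpF
    have h1 := (hJ _).1 hm.1 j hj
    rw [dot_add_r, dot_smul_r, dot_sub_r] at h1
    have h2 := hpj j hj hne
    by_contra hcon
    push Not at hcon
    nlinarith
  have hev : ∀ᶠ t : ℝ in nhds 0, ∀ j ∈ J, j ≠ i → dot (a j) (z + t • (z - y)) < c j := by
    rw [Filter.eventually_all_finset]
    intro j hj
    by_cases hji : j = i
    · exact Filter.Eventually.of_forall fun t h => absurd hji h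
    · filter_upwards [ev_strict (a j) (c j) z (z - y) (hzj j hj hji)] with t ht _ using ht
  obtain ⟨t, ht, hm⟩ := ev_pos hev
  have hopen : IsOpen {x | ∀ j ∈ J, dot (a j) x < c j} := by
    have : {x | ∀ j ∈ J, dot (a j) x < c j} = ⋂ j ∈ J, {x | dot (a j) x < c j} := by
      ext x; simp
    rw [this]
    exact isOpen_biInter_finset fun j _ => isOpen_lt (continuous_dot _) continuous_const
  have hq : z + t • (z - y) ∈ interior C := by
    refine interior_maximal (fun x hx => hBC ((hJ x).2 fun j hj => (hx j hj).le)) hopen ?_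
    intro j hj
    by_cases hji : j = i
    · subst hji
      rw [dot_add_r, dot_smul_r, dot_sub_r, hzF.2]
      nlinarith
    · exact hm j hj hji
  refine hCfree z ?_ hzS
  apply hC.openSegment_interior_self_subset_interior hq hy
  refine ⟨1 / (1 + t), t / (1 + t), by positivity, by positivity, by field_simp, ?_⟩
  have h1 : (1 / (1 + t)) * (1 + t) = 1 := by field_simp
  have h2 : (1 / (1 + t)) * t = t / (1 + t) := by ring
  rw [smul_add, smul_smul, h2]
  have h3 : (1 / (1 + t)) = 1 - t / (1 + t) := by field_simp; try ring
  rw [add_assoc, ← smul_add, sub_add_cancel, h3, sub_smul, one_smul, sub_add_cancel]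

/-- Characterization of maximal S-free convex sets: the "if" direction. -/
theorem stmt_2 {n : ℕ} (S : Set (E n)) (hS : IsIntPtsOfRatPolyhedron S)
    (hdim : FullDimSet S) (B : Set (E n))
    (hcases :
      (IsPolyhedron B ∧ (interior (B ∩ convexHull ℝ S)).Nonempty ∧
        (∀ x ∈ interior B, x ∉ S) ∧
        (∀ F : Set (E n), IsFacetOf F B → ∃ z ∈ S, z ∈ intrinsicInterior ℝ F))
      ∨ (∃ (a : E n) (β : ℝ), a ≠ 0 ∧ B = {x | dot a x ≤ β} ∧
          interior (B ∩ convexHull ℝ S) = ∅ ∧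
          IsSupportingHyperplane a β (convexHull ℝ S))
      ∨ (∃ (a : E n) (β : ℝ), a ≠ 0 ∧ B = {x | dot a x = β} ∧
          ¬ IsRationalCone (linSpace B ∩ recCone (convexHull ℝ S)))) :
    MaxSFree S B := by
  obtain ⟨p, hp, -⟩ := id hdim
  rcases hcases with ⟨hpoly, hint, hfree, hfac⟩ | ⟨a, β, ha, rfl, hemp, hsup⟩ | ⟨a, β, ha, rfl, h⟩
  · exact case_i S B hpoly (hint.mono (interior_mono Set.inter_subset_left)) hfree hfac
  · exact case_ii S hdim a β ha hemp hsup
  · exact case_iii S hS ⟨p 0, hp 0⟩ a β ha h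
end
end

section
/- If B ⊂ ℝⁿ is a maximal S-free convex set such that B ∩ conv(S) has nonempty interior, then B is a polyhedron, i.e., B is a finite intersection of closed half-spaces. -/
open scoped BigOperators Pointwise

noncomputable section

section Helpers

open Filter Topology

/-- The dot product as a continuous linear functional. -/
def dotL {n : ℕ} (a : E n) : E n →L[ℝ] ℝ :=
  LinearMap.toContinuousLinearMap
    { toFun := fun x => dot a x
      map_add' := by
        intro x y
        simp only [dot, PiLp.add_apply, mul_add, Finset.sum_add_distrib]
      map_smul' := by
        intro c x
        simp only [dot, PiLp.smul_apply, smul_eq_mul, RingHom.id_apply, Finset.mul_sum]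
        exact Finset.sum_congr rfl fun i _ => by ring }

lemma dotL_apply {n : ℕ} (a x : E n) : dotL a x = dot a x := rfl

/-- Every continuous linear functional is a dot product. -/
lemma exists_dot_rep {n : ℕ} (f : E n →L[ℝ] ℝ) : ∃ a : E n, ∀ x, f x = dot a x := by
  refine ⟨WithLp.toLp 2 fun i => f (EuclideanSpace.single i 1), fun x => ?_⟩
  have hx : x = ∑ i, x i • (EuclideanSpace.single i (1 : ℝ) : E n) := by
    have := (EuclideanSpace.basisFun (Fin n) ℝ).sum_repr x
    simpa using this.symm
  conv_lhs => rw [hx]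
  simp only [map_sum, map_smul, smul_eq_mul, dot]
  exact Finset.sum_congr rfl fun i _ => by ring

lemma IsIntPt.add {n : ℕ} {x y : E n} (hx : IsIntPt x) (hy : IsIntPt y) : IsIntPt (x + y) := by
  intro i
  obtain ⟨a, ha⟩ := hx i
  obtain ⟨b, hb⟩ := hy i
  exact ⟨a + b, by simp [ha, hb]⟩

lemma IsIntPt.sub {n : ℕ} {x y : E n} (hx : IsIntPt x) (hy : IsIntPt y) : IsIntPt (x - y) := by
  intro i
  obtain ⟨a, ha⟩ := hx i
  obtain ⟨b, hb⟩ := hy i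
  exact ⟨a - b, by simp [ha, hb]⟩

lemma IsIntPt.zsmul {n : ℕ} {x : E n} (hx : IsIntPt x) (m : ℤ) : IsIntPt ((m : ℝ) • x) := by
  intro i
  obtain ⟨a, ha⟩ := hx i
  exact ⟨m * a, by simp [ha]⟩

lemma countable_intPt (n : ℕ) : {x : E n | IsIntPt x}.Countable := by
  have : {x : E n | IsIntPt x} ⊆
      Set.range (fun z : Fin n → ℤ => (WithLp.toLp 2 fun i => (z i : ℝ) : E n)) := by
    intro x hx
    choose z hz using hx
    exact ⟨z, by ext i; simp [hz]⟩
  exact (Set.countable_range _).mono this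

/-- Rational functionals take discrete values on integral points. -/
lemma rat_gap {n : ℕ} (a : E n) (ha : IsRatVec a) :
    ∃ δ : ℝ, 0 < δ ∧ ∀ z : E n, IsIntPt z → |dot a z| < δ → dot a z = 0 := by
  choose q hq using ha
  have hD : (0 : ℝ) < ((∏ i, (q i).den : ℕ) : ℝ) := by
    exact_mod_cast Finset.prod_pos fun i _ => (q i).den_pos
  refine ⟨1 / ((∏ i, (q i).den : ℕ) : ℝ), by positivity, fun z hz hlt => ?_⟩
  set D : ℕ := ∏ i, (q i).den with hDdef
  have h1 : ∀ i, ∃ k : ℤ, (D : ℝ) * a i = k := by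
    intro i
    obtain ⟨c, hc⟩ : (q i).den ∣ D := Finset.dvd_prod_of_mem _ (Finset.mem_univ i)
    refine ⟨c * (q i).num, ?_⟩
    rw [hq i, hc]
    have : ((q i : ℚ) : ℝ) * ((q i).den : ℝ) = ((q i).num : ℝ) := by
      exact_mod_cast Rat.mul_den_eq_num (q i)
    push_cast
    rw [← this]; ring
  choose k hk using h1
  choose m hm using hz
  have h2 : (D : ℝ) * dot a z = ((∑ i, k i * m i : ℤ) : ℝ) := by
    push_cast
    rw [dot, Finset.mul_sum]
    exact Finset.sum_congr rfl fun i _ => by rw [← hk, ← hm]; ring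
  have h3 : |((∑ i, k i * m i : ℤ) : ℝ)| < 1 := by
    rw [← h2, abs_mul, abs_of_pos hD]
    rw [lt_div_iff₀ hD] at hlt
    linarith
  have h4 : (∑ i, k i * m i : ℤ) = 0 := by
    rw [← Int.abs_lt_one_iff]
    exact_mod_cast h3
  rw [h4] at h2
  simp only [Int.cast_zero, mul_eq_zero] at h2
  exact h2.resolve_left hD.ne'

lemma rat_gap_all {n m : ℕ} (A : Fin m → E n) (hA : ∀ i, IsRatVec (A i)) :
    ∃ δ : ℝ, 0 < δ ∧ ∀ i, ∀ z : E n, IsIntPt z → |dot (A i) z| < δ → dot (A i) z = 0 := by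
  have h : ∀ᶠ δ : ℝ in 𝓝[>] 0, ∀ i, ∀ z : E n, IsIntPt z → |dot (A i) z| < δ →
      dot (A i) z = 0 := by
    rw [eventually_all]
    intro i
    obtain ⟨δ, hδ, h⟩ := rat_gap (A i) (hA i)
    filter_upwards [Ioo_mem_nhdsGT hδ] with x hx z hz hlt
    exact h z hz (hlt.trans hx.2)
  obtain ⟨δ, h1, h2⟩ := (h.and self_mem_nhdsWithin).exists
  exact ⟨δ, h2, h1⟩

/-- Simultaneous Dirichlet-type recurrence. -/
lemma recurrence {n : ℕ} (d : E n) (ε : ℝ) (hε : 0 < ε) (N0 : ℕ) :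
    ∃ N : ℕ, N0 ≤ N ∧ ∃ z : E n, IsIntPt z ∧ ‖z - (N : ℝ) • d‖ < ε := by
  let fl : ℕ → E n := fun k => WithLp.toLp 2 fun i => ((⌊(k : ℝ) * d i⌋ : ℤ) : ℝ)
  have hfl : ∀ k, IsIntPt (fl k) := fun k i => ⟨⌊(k : ℝ) * d i⌋, rfl⟩
  have hc : IsCompact ((fun v : Fin n → ℝ => (WithLp.toLp 2 v : E n)) ''
      (Set.univ.pi fun _ => Set.Icc (0 : ℝ) 1)) :=
    (isCompact_univ_pi fun _ => isCompact_Icc).image (PiLp.continuous_toLp 2 _)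
  have hmem : ∀ k : ℕ, (k : ℝ) • d - fl k ∈ ((fun v : Fin n → ℝ => (WithLp.toLp 2 v : E n)) ''
      (Set.univ.pi fun _ => Set.Icc (0 : ℝ) 1)) := by
    intro k
    refine ⟨fun i => Int.fract ((k : ℝ) * d i), fun i _ => ⟨Int.fract_nonneg _,
      (Int.fract_lt_one _).le⟩, ?_⟩
    ext i
    simp [fl]
  obtain ⟨a, -, φ, hφ, hlim⟩ := hc.tendsto_subseq hmem
  obtain ⟨J, hJ⟩ := Metric.cauchySeq_iff.1 hlim.cauchySeq ε hε
  have h1 := hJ (J + (N0 + φ J)) (by simp) J le_rfl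
  have h2 : N0 + φ J ≤ φ (J + (N0 + φ J)) := by
    have := hφ.le_apply (x := J + (N0 + φ J)); omega
  refine ⟨φ (J + (N0 + φ J)) - φ J, by omega, fl (φ (J + (N0 + φ J))) - fl (φ J),
    (hfl _).sub (hfl _), ?_⟩
  rw [dist_eq_norm, ← norm_neg] at h1
  refine lt_of_eq_of_lt ?_ h1
  congr 1
  rw [Nat.cast_sub (by omega), sub_smul]
  simp only [Function.comp]
  abel

/-- Integral recession directions of `Q` near `r + N d`. -/
lemma int_near {n m : ℕ} (A : Fin m → E n) (hA : ∀ i, IsRatVec (A i)) (d r : E n)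
    (hd : ∀ i, dot (A i) d ≤ 0) (hr : IsIntPt r) (hr0 : ∀ i, dot (A i) d = 0 → dot (A i) r = 0)
    (ε : ℝ) (hε : 0 < ε) (N0 : ℕ) :
    ∃ N : ℕ, N0 ≤ N ∧ ∃ z : E n, IsIntPt z ∧ (∀ i, dot (A i) z ≤ 0) ∧
      ‖z - r - (N : ℝ) • d‖ < ε := by
  obtain ⟨δ, hδ, hgap⟩ := rat_gap_all A hA
  have hsmall : ∀ᶠ η : ℝ in 𝓝[>] 0, η < ε ∧ ∀ i, ‖dotL (A i)‖ * η < δ := by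
    have h0 : ∀ᶠ η : ℝ in 𝓝[>] 0, η < ε := by
      filter_upwards [Ioo_mem_nhdsGT hε] with x hx using hx.2
    refine h0.and ?_
    rw [eventually_all]
    intro i
    have : Tendsto (fun η : ℝ => ‖dotL (A i)‖ * η) (𝓝[>] 0) (𝓝 (‖dotL (A i)‖ * 0)) :=
      (tendsto_id.const_mul _).mono_left nhdsWithin_le_nhds
    rw [mul_zero] at this
    exact this.eventually (gt_mem_nhds hδ)
  obtain ⟨η, ⟨hηε, hηδ⟩, hη⟩ := (hsmall.and self_mem_nhdsWithin).exists
  have hη : 0 < η := hη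
  have hlarge : ∀ᶠ N : ℕ in atTop, ∀ i, dot (A i) d < 0 →
      dot (A i) r + δ + (N : ℝ) * dot (A i) d ≤ 0 := by
    rw [eventually_all]
    intro i
    by_cases h : dot (A i) d < 0
    · have : Tendsto (fun N : ℕ => dot (A i) r + δ + (N : ℝ) * dot (A i) d) atTop atBot :=
        tendsto_atBot_add_const_left _ _
          (tendsto_natCast_atTop_atTop.atTop_mul_const_of_neg h)
      filter_upwards [this.eventually_le_atBot 0] with N hN _ using hN
    · exact Eventually.of_forall fun _ h' => absurd h' h
  obtain ⟨N1, hN1⟩ := eventually_atTop.1 hlarge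
  obtain ⟨N, hN, z, hz, hzd⟩ := recurrence d η hη (max N0 N1)
  have herr : ∀ i, |dot (A i) z - (N : ℝ) * dot (A i) d| < δ := by
    intro i
    have h1 := (dotL (A i)).le_opNorm (z - (N : ℝ) • d)
    rw [map_sub, map_smul, dotL_apply, dotL_apply, Real.norm_eq_abs, smul_eq_mul] at h1
    exact h1.trans_lt ((mul_le_mul_of_nonneg_left hzd.le (norm_nonneg _)).trans_lt (hηδ i))
  refine ⟨N, (le_max_left _ _).trans hN, r + z, hr.add hz, fun i => ?_, ?_⟩
  · have hadd : dot (A i) (r + z) = dot (A i) r + dot (A i) z := (dotL (A i)).map_add r z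
    rw [hadd]
    have h2 := herr i
    rcases (hd i).lt_or_eq with h | h
    · have := hN1 N ((le_max_right _ _).trans hN) i h
      have := (abs_lt.1 h2).2
      linarith
    · rw [h, mul_zero, sub_zero] at h2
      rw [hr0 i h, hgap i z hz h2, add_zero]
  · rw [add_sub_cancel_left]
    exact hzd.trans hηε

/-- Decomposition of an unbounded sequence: modulo a subspace `U` of `L` it is bounded. -/
lemma decomp {n m : ℕ} (g : Fin m → (E n →L[ℝ] ℝ)) (b : Fin m → ℝ)
    (f : ℕ → (E n →L[ℝ] ℝ)) (c : ℕ → ℝ) (L : Submodule ℝ (E n))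
    (hL : ∀ d, d ∈ L ↔ ∀ k, f k d = 0)
    (hK : ∀ d, (∀ i, g i d ≤ 0) → (∀ k, f k d ≤ 0) → d ∈ L)
    (s : ℕ → E n) (hg : ∀ N i, g i (s N) ≤ b i) (hf : ∀ k, ∀ᶠ N in atTop, f k (s N) ≤ c k) :
    ∃ U : Submodule ℝ (E n), U ≤ L ∧ ∃ u ∈ U, (∀ i, g i u ≤ 0) ∧
      (∀ i, g i u = 0 → ∀ v ∈ U, g i v = 0) ∧
      ∃ φ : ℕ → ℕ, StrictMono φ ∧ ∃ a : E n,
        Tendsto (fun N => Uᗮ.starProjection (s (φ N))) atTop (𝓝 a) := by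
  obtain ⟨U, ⟨hUL, u, huU, hu, hu0⟩, hmax⟩ := wellFounded_gt.has_min
    {U : Submodule ℝ (E n) | U ≤ L ∧ ∃ u ∈ U, (∀ i, g i u ≤ 0) ∧
      (∀ i, g i u = 0 → ∀ v ∈ U, g i v = 0)} ⟨⊥, bot_le, 0, by simp, by simp, by
        intro i _ v hv; rw [(Submodule.mem_bot ℝ).1 hv, map_zero]⟩
  refine ⟨U, hUL, u, huU, hu, hu0, ?_⟩
  set y : ℕ → E n := fun N => Uᗮ.starProjection (s N) with hy
  have hyU : ∀ N, s N - y N ∈ U := by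
    intro N
    have : s N - y N = U.starProjection (s N) := by
      simp [hy, Submodule.starProjection_orthogonal]
    rw [this]
    exact Submodule.starProjection_apply_mem _ _
  by_cases hbdd : ∃ R : ℝ, ∃ᶠ N in atTop, y N ∈ Metric.closedBall (0 : E n) R
  · obtain ⟨R, hR⟩ := hbdd
    obtain ⟨a, -, φ, hφ, hlim⟩ := tendsto_subseq_of_frequently_bounded
      Metric.isBounded_closedBall hR
    exact ⟨φ, hφ, a, hlim⟩
  exfalso
  push Not at hbdd
  have hinf : Tendsto (fun N => ‖y N‖) atTop atTop := by
    rw [tendsto_atTop]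
    intro R
    filter_upwards [hbdd R] with N hN
    rw [mem_closedBall_zero_iff, not_le] at hN
    exact hN.le
  obtain ⟨d, -, φ, hφ, hlim⟩ := tendsto_subseq_of_bounded
    (Metric.isBounded_closedBall (x := (0 : E n)) (r := 1)) (x := fun N => ‖y N‖⁻¹ • y N) (by
      intro N
      rw [mem_closedBall_zero_iff, norm_smul, norm_inv, norm_norm]
      exact inv_mul_le_one)
  have hinf' : Tendsto (fun N => ‖y (φ N)‖) atTop atTop := hinf.comp hφ.tendsto_atTop
  have hdnorm : ‖d‖ = 1 := by
    refine tendsto_nhds_unique hlim.norm ?_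
    refine tendsto_const_nhds.congr' ?_
    filter_upwards [hinf'.eventually_gt_atTop 0] with N hN
    simp only [Function.comp]
    rw [norm_smul, norm_inv, norm_norm, inv_mul_cancel₀ hN.ne']
  have hdU : d ∈ Uᗮ := by
    refine (Submodule.closed_of_finiteDimensional Uᗮ).mem_of_tendsto hlim
      (Eventually.of_forall fun N => ?_)
    exact Uᗮ.smul_mem _ (Submodule.starProjection_apply_mem _ _)
  have key : ∀ (h : E n →L[ℝ] ℝ) (C : ℝ), (∀ᶠ N in atTop, h (y N) ≤ C) → h d ≤ 0 := by
    intro h C hC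
    have h1 : Tendsto (fun N => ‖y (φ N)‖⁻¹ * C) atTop (𝓝 (0 * C)) :=
      (tendsto_inv_atTop_zero.comp hinf').mul_const C
    rw [zero_mul] at h1
    refine le_of_tendsto_of_tendsto ((h.continuous.tendsto d).comp hlim) h1 ?_
    filter_upwards [hφ.tendsto_atTop.eventually hC] with N hN
    simp only [Function.comp, map_smul, smul_eq_mul]
    exact mul_le_mul_of_nonneg_left hN (inv_nonneg.2 (norm_nonneg _))
  have hfd : ∀ k, f k d ≤ 0 := by
    intro k
    refine key (f k) (c k) ?_
    filter_upwards [hf k] with N hN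
    have := (hL _).1 (hUL (hyU N)) k
    rw [map_sub] at this
    linarith
  have hgd : ∀ i, g i u = 0 → g i d ≤ 0 := by
    intro i hi
    refine key (g i) (b i) (Eventually.of_forall fun N => ?_)
    have := hu0 i hi _ (hyU N)
    rw [map_sub] at this
    linarith [hg N i]
  have hlarge : ∀ᶠ M : ℝ in atTop, ∀ i, g i u < 0 → M * g i u + g i d < 0 := by
    rw [eventually_all]
    intro i
    by_cases h : g i u < 0
    · have : Tendsto (fun M : ℝ => M * g i u + g i d) atTop atBot :=
        tendsto_atBot_add_const_right _ _ (tendsto_id.atTop_mul_const_of_neg h)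
      filter_upwards [this.eventually_lt_atBot 0] with N hN _ using hN
    · exact Eventually.of_forall fun _ h' => absurd h' h
  obtain ⟨M, hM⟩ := hlarge.exists
  have hu' : ∀ i, g i (M • u + d) ≤ 0 := by
    intro i
    rw [map_add, map_smul, smul_eq_mul]
    rcases (hu i).lt_or_eq with h | h
    · exact (hM i h).le
    · rw [h, mul_zero, zero_add]; exact hgd i h
  have hdL : d ∈ L := by
    have h1 : M • u + d ∈ L := by
      refine hK _ hu' fun k => ?_
      rw [map_add, map_smul, (hL u).1 (hUL huU) k, smul_zero, zero_add]
      exact hfd k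
    have := L.sub_mem h1 (L.smul_mem M (hUL huU))
    simpa using this
  refine hmax (U ⊔ Submodule.span ℝ {d}) ⟨?_, M • u + d, ?_, hu', ?_⟩ ?_
  · exact sup_le hUL ((Submodule.span_singleton_le_iff_mem _ _).2 hdL)
  · exact Submodule.add_mem_sup (U.smul_mem _ huU) (Submodule.mem_span_singleton_self d)
  · intro i hi v hv
    rw [map_add, map_smul, smul_eq_mul] at hi
    have hui : g i u = 0 := by
      by_contra h
      exact (hM i (lt_of_le_of_ne (hu i) h)).ne hi
    have hdi : g i d = 0 := by simpa [hui] using hi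
    obtain ⟨p, hp, q, hq, rfl⟩ := Submodule.mem_sup.1 hv
    obtain ⟨a, rfl⟩ := Submodule.mem_span_singleton.1 hq
    rw [map_add, map_smul, hu0 i hui p hp, hdi, smul_zero, add_zero]
  · refine lt_of_le_of_ne le_sup_left fun h => ?_
    have hdU' : d ∈ U := by
      rw [h]; exact Submodule.mem_sup_right (Submodule.mem_span_singleton_self d)
    have := Submodule.inner_right_of_mem_orthogonal hdU' hdU
    rw [inner_self_eq_zero] at this
    rw [this, norm_zero] at hdnorm
    exact zero_ne_one hdnorm

/-- Small nonzero elements of a subgroup (modulo `L`) accumulate to a full line. -/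
lemma line_of_small {n : ℕ} (L : Submodule ℝ (E n)) (Γ : Set (E n))
    (hΓ : ∀ r ∈ Γ, ∀ m : ℤ, (m : ℝ) • r ∈ Γ)
    (hsmall : ∀ ε : ℝ, 0 < ε → ∃ r ∈ Γ, r ∉ L ∧ ‖Lᗮ.starProjection r‖ < ε) :
    ∃ w : E n, w ∉ L ∧ ∀ (t ε : ℝ), 0 < ε → ∃ r ∈ Γ, ∃ l ∈ L, ‖t • w - r - l‖ < ε := by
  have h1 : ∀ N : ℕ, ∃ r ∈ Γ, r ∉ L ∧ ‖Lᗮ.starProjection r‖ < 1 / ((N : ℝ) + 1) :=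
    fun N => hsmall _ (by positivity)
  choose r hrΓ hrL hr using h1
  set v : ℕ → E n := fun N => Lᗮ.starProjection (r N) with hv
  have hvL : ∀ N, r N - v N ∈ L := by
    intro N
    have : r N - v N = L.starProjection (r N) := by
      simp [hv, Submodule.starProjection_orthogonal]
    rw [this]
    exact Submodule.starProjection_apply_mem _ _
  have hv0 : ∀ N, v N ≠ 0 := by
    intro N h
    apply hrL N
    have := hvL N
    rwa [h, sub_zero] at this
  have hlim0 : Tendsto (fun N => ‖v N‖) atTop (𝓝 0) :=
    squeeze_zero (fun _ => norm_nonneg _) (fun N => (hr N).le)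
      tendsto_one_div_add_atTop_nhds_zero_nat
  obtain ⟨w, hw, φ, hφ, hlim⟩ := (isCompact_sphere (0 : E n) 1).tendsto_subseq
    (x := fun N => ‖v N‖⁻¹ • v N) (by
      intro N
      rw [mem_sphere_zero_iff_norm, norm_smul, norm_inv, norm_norm,
        inv_mul_cancel₀ (norm_ne_zero_iff.2 (hv0 N))])
  have hwL : w ∈ Lᗮ := by
    refine (Submodule.closed_of_finiteDimensional Lᗮ).mem_of_tendsto hlim
      (Eventually.of_forall fun N => ?_)
    exact Lᗮ.smul_mem _ (Submodule.starProjection_apply_mem _ _)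
  refine ⟨w, fun hwL' => ?_, fun t ε hε => ?_⟩
  · have := Submodule.inner_right_of_mem_orthogonal hwL' hwL
    rw [inner_self_eq_zero] at this
    rw [this] at hw
    simp at hw
  · have e1 : ∀ᶠ N in atTop, ‖t • w - t • (‖v (φ N)‖⁻¹ • v (φ N))‖ < ε / 2 := by
      have : Tendsto (fun N => ‖t • w - t • (‖v (φ N)‖⁻¹ • v (φ N))‖) atTop
          (𝓝 ‖t • w - t • w‖) := (tendsto_const_nhds.sub (hlim.const_smul t)).norm
      rw [sub_self, norm_zero] at this
      exact this.eventually (gt_mem_nhds (half_pos hε))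
    have e2 : ∀ᶠ N in atTop, ‖v (φ N)‖ < ε / 2 :=
      (hlim0.comp hφ.tendsto_atTop).eventually (gt_mem_nhds (half_pos hε))
    obtain ⟨N, h1, h2⟩ := (e1.and e2).exists
    set q := t * ‖v (φ N)‖⁻¹ with hq
    refine ⟨((⌊q⌋ : ℤ) : ℝ) • r (φ N), hΓ _ (hrΓ _) _,
      -(((⌊q⌋ : ℤ) : ℝ) • (r (φ N) - v (φ N))), L.neg_mem (L.smul_mem _ (hvL _)), ?_⟩
    have e3 : t • w - ((⌊q⌋ : ℤ) : ℝ) • r (φ N) - -(((⌊q⌋ : ℤ) : ℝ) • (r (φ N) - v (φ N)))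
        = (t • w - t • (‖v (φ N)‖⁻¹ • v (φ N))) + Int.fract q • v (φ N) := by
      rw [smul_smul, ← hq, Int.fract, sub_smul, smul_sub]
      abel
    rw [e3]
    have e4 : ‖Int.fract q • v (φ N)‖ ≤ ‖v (φ N)‖ := by
      rw [norm_smul, Real.norm_eq_abs, abs_of_nonneg (Int.fract_nonneg _)]
      exact mul_le_of_le_one_left (norm_nonneg _) (Int.fract_lt_one _).le
    calc _ ≤ _ := norm_add_le _ _
      _ < ε := by linarith

/-- Consequence of maximality: a direction `w` whose lines through `int B` miss `S`
can be added to `B`. -/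
lemma max_line {n : ℕ} {S B : Set (E n)} (hB : MaxSFree S B) (hint : (interior B).Nonempty)
    (w : E n) (hw : ∀ x ∈ interior B, ∀ t : ℝ, x + t • w ∉ S) :
    ∀ x ∈ interior B, ∀ t : ℝ, x + t • w ∈ B := by
  obtain ⟨hconv, hfree, hmax⟩ := hB
  set C : Set (E n) := interior B + ((Submodule.span ℝ {w} : Submodule ℝ (E n)) : Set (E n))
    with hC
  have hCopen : IsOpen C := isOpen_interior.add_right
  have hCconv : Convex ℝ C := hconv.interior.add (Submodule.convex _)
  have hsub : interior B ⊆ C := fun x hx => ⟨x, hx, 0, Submodule.zero_mem _, add_zero x⟩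
  have hCne : (interior C).Nonempty := by
    rw [hCopen.interior_eq]; exact hint.mono hsub
  have hBC : B ⊆ closure C := by
    refine subset_closure.trans ?_
    rw [← hconv.closure_interior_eq_closure_of_nonempty_interior hint]
    exact closure_mono hsub
  have hfreeC : SFree S (closure C) := by
    intro x hx
    rw [hCconv.interior_closure_eq_interior_of_nonempty_interior hCne, hCopen.interior_eq] at hx
    obtain ⟨y, hy, v, hv, rfl⟩ := hx
    obtain ⟨t, rfl⟩ := Submodule.mem_span_singleton.1 hv
    exact hw y hy t
  have hEq := hmax _ hCconv.closure hfreeC hBC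
  intro x hx t
  rw [hEq]
  exact subset_closure ⟨x, hx, t • w, Submodule.smul_mem _ _ (Submodule.mem_span_singleton_self w),
    rfl⟩

lemma lin_bdd {a b C : ℝ} (h : ∀ t : ℝ, a + t * b ≤ C) : b = 0 := by
  by_contra hb
  have := h ((C - a + 1) / b)
  rw [div_mul_cancel₀ _ hb] at this
  linarith

/-- The main argument. -/
lemma main_aux {n : ℕ} (S : Set (E n)) (hS : IsIntPtsOfRatPolyhedron S)
    (hSne : S.Nonempty) (B : Set (E n)) (hB : MaxSFree S B) (hint : (interior B).Nonempty) :
    IsPolyhedron B := by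
  obtain ⟨m, A, b, hA, -, hSeq⟩ := hS
  have hSint : ∀ x ∈ S, IsIntPt x := fun x hx => by rw [hSeq] at hx; exact hx.1
  have hSle : ∀ x ∈ S, ∀ i, dot (A i) x ≤ b i := fun x hx => by rw [hSeq] at hx; exact hx.2
  have hSadd : ∀ x ∈ S, ∀ z, IsIntPt z → (∀ i, dot (A i) z ≤ 0) → x + z ∈ S := by
    intro x hx z hz hz'
    rw [hSeq]
    refine ⟨(hSint x hx).add hz, fun i => ?_⟩
    have : dot (A i) (x + z) = dot (A i) x + dot (A i) z := (dotL (A i)).map_add x z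
    linarith [hSle x hx i, hz' i]
  obtain ⟨hconv, hfree, hmax⟩ := id hB
  obtain ⟨t, ht⟩ := ((countable_intPt n).mono fun x hx => hSint x hx : S.Countable).exists_eq_range
    hSne
  have htS : ∀ k, t k ∈ S := fun k => by rw [ht]; exact ⟨k, rfl⟩
  -- separating functionals
  have hsep : ∀ k, ∃ f : E n →L[ℝ] ℝ, ∀ x ∈ interior B, f x < f (t k) := fun k =>
    geometric_hahn_banach_open_point hconv.interior isOpen_interior
      fun h => hfree _ h (htS k)
  choose f hf using hsep
  obtain ⟨x0, hx0⟩ := id hint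
  have hBf : ∀ x ∈ B, ∀ k, f k x ≤ f k (t k) := by
    intro x hx k
    have h1 : x ∈ closure (interior B) := by
      rw [hconv.closure_interior_eq_closure_of_nonempty_interior hint]
      exact subset_closure hx
    have h2 : closure (interior B) ⊆ {x | f k x ≤ f k (t k)} :=
      closure_minimal (fun y hy => (hf k y hy).le)
        (isClosed_le (f k).continuous continuous_const)
    exact h2 h1
  -- strictness in the interior of a half-space
  have hstrict : ∀ (k : ℕ) (C : Set (E n)), (∀ x ∈ C, f k x ≤ f k (t k)) →
      ∀ x ∈ interior C, f k x < f k (t k) := by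
    intro k C hC x hx
    have hlim : Tendsto (fun η : ℝ => x + η • (t k - x0)) (𝓝[>] 0)
        (𝓝 (x + (0 : ℝ) • (t k - x0))) := by
      refine Tendsto.mono_left (Continuous.tendsto ?_ _) nhdsWithin_le_nhds
      fun_prop
    rw [zero_smul, add_zero] at hlim
    obtain ⟨η, h1, h2⟩ := ((hlim.eventually (isOpen_interior.mem_nhds hx)).and
      self_mem_nhdsWithin).exists
    have h2 : 0 < η := h2
    have h3 := hC _ (interior_subset h1)
    rw [map_add, map_smul, map_sub, smul_eq_mul] at h3
    have := mul_pos h2 (sub_pos.2 (hf k x0 hx0))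
    linarith
  have hconvH : ∀ p : ℕ → Prop, Convex ℝ {x : E n | ∀ k, p k → f k x ≤ f k (t k)} := by
    intro p
    have : {x : E n | ∀ k, p k → f k x ≤ f k (t k)} =
        ⋂ k, ⋂ _ : p k, {x | f k x ≤ f k (t k)} := by
      ext x; simp
    rw [this]
    exact convex_iInter fun k => convex_iInter fun _ =>
      convex_halfSpace_le (f k).toLinearMap.isLinear _
  by_cases hfin : ∃ N : ℕ, SFree S {x : E n | ∀ k, k ≤ N → f k x ≤ f k (t k)}
  · -- finitely many half-spaces suffice
    obtain ⟨N, hN⟩ := hfin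
    have hEq := hmax _ (hconvH fun k => k ≤ N) hN fun x hx k _ => hBf x hx k
    choose a ha using fun k => exists_dot_rep (f k)
    refine ⟨N + 1, fun i => a i, fun i => f i (t i), ?_⟩
    rw [hEq]
    ext x
    constructor
    · intro h i
      rw [← ha]
      exact h i (Nat.lt_succ_iff.1 i.2)
    · intro h k hk
      have := h ⟨k, Nat.lt_succ_iff.2 hk⟩
      rwa [← ha] at this
  exfalso
  push Not at hfin
  have hex : ∀ N : ℕ, ∃ s ∈ S, ∀ k ≤ N, f k s < f k (t k) := by
    intro N
    have := hfin N
    unfold SFree at this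
    push Not at this
    obtain ⟨s, hs, hsS⟩ := this
    exact ⟨s, hsS, fun k hk => hstrict k {x : E n | ∀ k, k ≤ N → f k x ≤ f k (t k)} (fun x hx => hx k hk) s hs⟩
  choose s hsS hs using hex
  -- `B` is the intersection of all half-spaces
  have hBEq : B = {x : E n | ∀ k, True → f k x ≤ f k (t k)} := by
    refine hmax _ (hconvH fun _ => True) ?_ fun x hx k _ => hBf x hx k
    intro x hx hxS
    rw [ht] at hxS
    obtain ⟨k, rfl⟩ := hxS
    exact lt_irrefl _ (hstrict k {x : E n | ∀ k, True → f k x ≤ f k (t k)}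
      (fun x hx => hx k trivial) _ hx)
  have hrec : ∀ d, (∀ k, f k d ≤ 0) → ∀ x ∈ interior B, x + d ∈ interior B := by
    intro d hd x hx
    have h1 : (fun y => y + d) '' interior B ⊆ interior B := by
      refine interior_maximal ?_ ((Homeomorph.addRight d).isOpenMap _ isOpen_interior)
      rintro _ ⟨y, hy, rfl⟩
      rw [hBEq]
      intro k _
      rw [map_add]
      linarith [hBf y (interior_subset hy) k, hd k]
    exact h1 ⟨x, hx, rfl⟩
  let L : Submodule ℝ (E n) := ⨅ k, LinearMap.ker (f k).toLinearMap
  have hL : ∀ d, d ∈ L ↔ ∀ k, f k d = 0 := by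
    intro d
    simp [L, Submodule.mem_iInf]
  have hrecL : ∀ d ∈ L, ∀ x ∈ interior B, x + d ∈ interior B := fun d hd =>
    hrec d fun k => ((hL d).1 hd k).le
  have hline : ∀ w : E n, (∀ x ∈ interior B, ∀ t : ℝ, x + t • w ∉ S) → w ∈ L := by
    intro w hw
    rw [hL]
    intro k
    refine lin_bdd (a := f k x0) (C := f k (t k)) fun c => ?_
    have := hBf _ (max_line hB hint w hw x0 hx0 c) k
    rwa [map_add, map_smul, smul_eq_mul] at this
  -- recession directions common to `B` and the polyhedron are lineality directions
  have hK : ∀ d, (∀ i, dotL (A i) d ≤ 0) → (∀ k, f k d ≤ 0) → d ∈ L := by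
    intro d hd1 hd2
    apply hline
    intro x hx c hxS
    obtain ⟨ε, hε, hball⟩ := Metric.isOpen_iff.1 isOpen_interior x hx
    obtain ⟨N0, hN0⟩ := exists_nat_ge (-c)
    obtain ⟨N, hN, z, hz, hz0, hzd⟩ := int_near A hA d 0 hd1 (fun i => ⟨0, by simp⟩)
      (fun i _ => (dotL (A i)).map_zero) ε hε N0
    have hN' : (N0 : ℝ) ≤ N := by exact_mod_cast hN
    rw [sub_zero] at hzd
    have h1 : x + (z - (N : ℝ) • d) ∈ interior B := hball (by
      rw [Metric.mem_ball, dist_eq_norm, add_sub_cancel_left]; exact hzd)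
    have h2 := hrec (((N : ℝ) + c) • d) (fun k => by
      rw [map_smul, smul_eq_mul]
      exact mul_nonpos_of_nonneg_of_nonpos (by linarith) (hd2 k)) _ h1
    have h3 : x + (z - (N : ℝ) • d) + ((N : ℝ) + c) • d = x + c • d + z := by
      rw [add_smul]; abel
    rw [h3] at h2
    exact hfree _ h2 (hSadd _ hxS z hz hz0)
  obtain ⟨U, hUL, u, huU, hu, hu0, φ, hφ, a, hlim⟩ := decomp (fun i => dotL (A i)) b f
    (fun k => f k (t k)) L hL hK s (fun N i => hSle _ (hsS N) i)
    (fun k => eventually_atTop.2 ⟨k, fun N hN => (hs N k hN).le⟩)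
  set Γ : Set (E n) := {r | IsIntPt r ∧ ∀ i, dotL (A i) u = 0 → dotL (A i) r = 0} with hΓ
  have hyU : ∀ N, s N - Uᗮ.starProjection (s N) ∈ U := by
    intro N
    have : s N - Uᗮ.starProjection (s N) = U.starProjection (s N) := by
      simp [Submodule.starProjection_orthogonal]
    rw [this]
    exact Submodule.starProjection_apply_mem _ _
  have hπL : ∀ v ∈ L, Lᗮ.starProjection v = 0 := by
    intro v hv
    rw [Submodule.starProjection_orthogonal]
    simp [Submodule.starProjection_eq_self_iff.2 hv]
  obtain ⟨δ, hδ, hgap⟩ := rat_gap_all A hA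
  have hdiff : ∀ p q, (s p - s q) - (Uᗮ.starProjection (s p) - Uᗮ.starProjection (s q)) ∈ U := by
    intro p q
    have := U.sub_mem (hyU p) (hyU q)
    convert this using 1
    abel
  have hsmall : ∀ ε : ℝ, 0 < ε → ∃ r ∈ Γ, r ∉ L ∧ ‖Lᗮ.starProjection r‖ < ε := by
    intro ε hε
    have hcau := hlim.cauchySeq
    have hev : ∀ᶠ η : ℝ in 𝓝[>] 0, ‖Lᗮ.starProjection‖ * η < ε ∧
        ∀ i, ‖dotL (A i)‖ * η < δ := by
      have hmul : ∀ c e : ℝ, 0 < e → ∀ᶠ η : ℝ in 𝓝[>] 0, c * η < e := by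
        intro c e he
        have : Tendsto (fun η : ℝ => c * η) (𝓝[>] 0) (𝓝 (c * 0)) :=
          (tendsto_id.const_mul _).mono_left nhdsWithin_le_nhds
        rw [mul_zero] at this
        exact this.eventually (gt_mem_nhds he)
      exact (hmul _ _ hε).and (eventually_all.2 fun i => hmul _ _ hδ)
    obtain ⟨η, ⟨hη1, hη2⟩, hη⟩ := (hev.and self_mem_nhdsWithin).exists
    have hη : 0 < η := hη
    obtain ⟨J, hJ⟩ := Metric.cauchySeq_iff.1 hcau η hη
    obtain ⟨k, hk⟩ : ∃ k, t k = s (φ J) := by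
      have := hsS (φ J)
      rw [ht] at this
      exact this
    have hd := hJ (J + k) (by simp) J le_rfl
    rw [dist_eq_norm] at hd
    set y := Uᗮ.starProjection (s (φ (J + k))) - Uᗮ.starProjection (s (φ J)) with hydef
    have hry : (s (φ (J + k)) - s (φ J)) - y ∈ U := hdiff _ _
    have hrint : IsIntPt (s (φ (J + k)) - s (φ J)) := (hSint _ (hsS _)).sub (hSint _ (hsS _))
    refine ⟨s (φ (J + k)) - s (φ J), ⟨hrint, fun i hi => ?_⟩, fun hmem => ?_, ?_⟩
    · have h1 := hu0 i hi _ hry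
      rw [map_sub, sub_eq_zero] at h1
      refine hgap i _ hrint ?_
      rw [← dotL_apply, h1, ← Real.norm_eq_abs]
      exact ((dotL (A i)).le_opNorm y).trans_lt
        ((mul_le_mul_of_nonneg_left hd.le (norm_nonneg _)).trans_lt (hη2 i))
    · have h1 := (hL _).1 hmem k
      rw [map_sub] at h1
      have h2 : k ≤ φ (J + k) := by
        have := hφ.le_apply (x := J + k); omega
      have h3 := hs _ k h2
      rw [hk] at h3
      linarith
    · have h1 := hπL _ (hUL hry)
      rw [map_sub, sub_eq_zero] at h1
      rw [h1]
      exact (Lᗮ.starProjection.le_opNorm y).trans_lt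
        ((mul_le_mul_of_nonneg_left hd.le (norm_nonneg _)).trans_lt hη1)
  obtain ⟨w, hwL, hw⟩ := line_of_small L Γ (by
    rintro r ⟨hr1, hr2⟩ c
    refine ⟨hr1.zsmul c, fun i hi => ?_⟩
    rw [map_smul, hr2 i hi, smul_zero]) hsmall
  apply hwL
  apply hline
  intro x hx c hxS
  obtain ⟨ε, hε, hball⟩ := Metric.isOpen_iff.1 isOpen_interior x hx
  obtain ⟨r, ⟨hr1, hr2⟩, l, hl, hrl⟩ := hw (-c) (ε / 2) (half_pos hε)
  obtain ⟨N, -, z, hz, hz0, hzd⟩ := int_near A hA u r hu hr1 hr2 (ε / 2) (half_pos hε) 0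
  have h1 : x + (-((-c) • w - r - l) + (z - r - (N : ℝ) • u)) ∈ interior B := hball (by
    rw [Metric.mem_ball, dist_eq_norm, add_sub_cancel_left]
    refine (norm_add_le _ _).trans_lt ?_
    rw [norm_neg]
    linarith)
  have h2 := hrecL ((N : ℝ) • u - l) (L.sub_mem (L.smul_mem _ (hUL huU)) hl) _ h1
  have h3 : x + (-((-c) • w - r - l) + (z - r - (N : ℝ) • u)) + ((N : ℝ) • u - l)
      = x + c • w + z := by
    rw [neg_smul]; abel
  rw [h3] at h2
  exact hfree _ h2 (hSadd _ hxS z hz hz0)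

end Helpers

/-- A maximal S-free convex set with int(B ∩ conv S) ≠ ∅ is a polyhedron. -/
theorem stmt_6 {n : ℕ} (S : Set (E n)) (hS : IsIntPtsOfRatPolyhedron S)
    (hdim : FullDimSet S) (B : Set (E n)) (hB : MaxSFree S B)
    (hne : (interior (B ∩ convexHull ℝ S)).Nonempty) :
    IsPolyhedron B := by
  obtain ⟨p, hp, -⟩ := hdim
  exact main_aux S hS ⟨p 0, hp 0⟩ B hB (hne.mono (interior_mono Set.inter_subset_left))
end
end
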